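/- arXiv:2504.01168 — 2 statements merged into one kernel-verified Lean document; each statement's English description precedes it below -/
import Mathlib

section
/- For all integers N ≥ 1 and n ≥ 1, the set of all n-qubit XP-operators of precision N, i.e. { XP_N(p|x|z) : p ∈ ℤ, x, z ∈ ℤⁿ }, is a subgroup of the group of invertible 2ⁿ × 2ⁿ complex matrices: it contains the identity matrix, is closed under matrix multiplication, and is closed under taking inverses. -/
open Matrix Kronecker

/-- ω = exp(πi/N), a primitive 2N-th root of unity. -/
noncomputable def omegaN (N : ℕ) : ℂ := Complex.exp (Real.pi * Complex.I / N)

/-- The 2×2 matrix X = [[0,1],[1,0]]. -/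
def Xm : Matrix (Fin 2) (Fin 2) ℂ := !![0, 1; 1, 0]

/-- The 2×2 matrix P = [[1,0],[0,ω²]] (precision N). -/
noncomputable def Pm (N : ℕ) : Matrix (Fin 2) (Fin 2) ℂ := !![1, 0; 0, (omegaN N) ^ 2]

/-- The n-qubit XP-operator of precision N:
`XP_N(p|x|z) = ω^p · (X^{x_n} P^{z_n}) ⊗ ⋯ ⊗ (X^{x_1} P^{z_1})`,
realized as a matrix indexed by bit strings `Fin n → Fin 2`
(the iterated Kronecker product has entries given by the product of the
entries of the single-qubit factors). -/
noncomputable def XPop (N n : ℕ) (p : ℤ) (x z : Fin n → ℤ) :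
    Matrix (Fin n → Fin 2) (Fin n → Fin 2) ℂ :=
  fun a b => (omegaN N) ^ p * ∏ i, ((Xm ^ (x i)) * (Pm N ^ (z i))) (a i) (b i)

/-- The set of all n-qubit XP-operators of precision N. -/
def XPset (N n : ℕ) : Set (Matrix (Fin n → Fin 2) (Fin n → Fin 2) ℂ) :=
  {M | ∃ (p : ℤ) (x z : Fin n → ℤ), M = XPop N n p x z}

lemma omegaN_ne_zero (N : ℕ) : omegaN N ≠ 0 := Complex.exp_ne_zero _

lemma Xm_mul_self : Xm * Xm = 1 := by
  simp [Xm, Matrix.one_fin_two]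

lemma isUnit_det_Xm : IsUnit Xm.det := by
  simp [Xm, Matrix.det_fin_two]

lemma isUnit_det_Pm (N : ℕ) : IsUnit (Pm N).det := by
  simp [Pm, Matrix.det_fin_two, omegaN_ne_zero]

lemma Pm_zpow (N : ℕ) (z : ℤ) : Pm N ^ z = !![1, 0; 0, omegaN N ^ (2 * z)] := by
  have h0 := omegaN_ne_zero N
  induction z using Int.induction_on with
  | zero => simp [Matrix.one_fin_two]
  | succ k ih =>
    rw [Matrix.zpow_add_one (isUnit_det_Pm N), ih, mul_add, zpow_add₀ h0]
    simp [Pm, zpow_ofNat]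
  | pred k ih =>
    have h : (Pm N)⁻¹ = !![1, 0; 0, omegaN N ^ (-2 : ℤ)] := by
      refine Matrix.inv_eq_right_inv ?_
      simp [Pm, Matrix.one_fin_two, h0, _root_.zpow_neg, zpow_ofNat]
    rw [Matrix.zpow_sub_one (isUnit_det_Pm N), ih, h,
      show (2 * (-(k : ℤ) - 1)) = 2 * -(k : ℤ) + (-2) by ring, zpow_add₀ h0]
    simp

lemma Xm_zpow_eq_one_or_eq (x : ℤ) : Xm ^ x = 1 ∨ Xm ^ x = Xm := by
  have h2 : Xm ^ (2 : ℤ) = 1 := by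
    rw [zpow_ofNat, pow_two, Xm_mul_self]
  rcases Int.even_or_odd' x with ⟨k, rfl | rfl⟩
  · left
    rw [Matrix.zpow_mul _ isUnit_det_Xm, h2, Matrix.one_zpow]
  · right
    rw [Matrix.zpow_add_one isUnit_det_Xm, Matrix.zpow_mul _ isUnit_det_Xm, h2, Matrix.one_zpow,
      one_mul]

/-- Moving a power of `P` past a power of `X` costs only a phase and a change of exponent. -/
lemma exists_Pm_zpow_mul_Xm_zpow (N : ℕ) (z x : ℤ) :
    ∃ q w : ℤ, Pm N ^ z * Xm ^ x = omegaN N ^ q • (Xm ^ x * Pm N ^ w) := by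
  rcases Xm_zpow_eq_one_or_eq x with h | h
  · exact ⟨0, z, by simp [h]⟩
  · refine ⟨2 * z, -z, ?_⟩
    have h0 : omegaN N ^ (2 * z) ≠ 0 := zpow_ne_zero _ (omegaN_ne_zero N)
    rw [h, Pm_zpow, Pm_zpow, mul_neg, _root_.zpow_neg]
    simp [Xm, h0]

lemma exists_mul_eq_smul_Xm_zpow_mul_Pm_zpow (N : ℕ) (x z x' z' : ℤ) :
    ∃ q u w : ℤ, (Xm ^ x * Pm N ^ z) * (Xm ^ x' * Pm N ^ z') =
      omegaN N ^ q • (Xm ^ u * Pm N ^ w) := by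
  obtain ⟨q, w, h⟩ := exists_Pm_zpow_mul_Xm_zpow N z x'
  refine ⟨q, x + x', w + z', ?_⟩
  rw [Matrix.zpow_add isUnit_det_Xm, Matrix.zpow_add (isUnit_det_Pm N)]
  calc _ = Xm ^ x * (Pm N ^ z * Xm ^ x') * Pm N ^ z' := by simp only [mul_assoc]
    _ = _ := by rw [h]; simp only [mul_assoc, Matrix.mul_smul, Matrix.smul_mul]

lemma exists_Xm_zpow_mul_Pm_zpow_mul_eq_one (N : ℕ) (x z : ℤ) :
    ∃ q u w : ℤ, (Xm ^ x * Pm N ^ z) * (omegaN N ^ q • (Xm ^ u * Pm N ^ w)) = 1 := by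
  obtain ⟨q, w, h⟩ := exists_Pm_zpow_mul_Xm_zpow N (-z) (-x)
  refine ⟨q, -x, w, ?_⟩
  rw [← h]
  calc _ = Xm ^ x * (Pm N ^ z * Pm N ^ (-z)) * Xm ^ (-x) := by simp only [mul_assoc]
    _ = 1 := by
      rw [← Matrix.zpow_add (isUnit_det_Pm N), add_neg_cancel, zpow_zero, mul_one,
        ← Matrix.zpow_add isUnit_det_Xm, add_neg_cancel, zpow_zero]

/-- The matrix `c • ⨂ᵢ M i`, indexed by tuples. -/
def smulTensor {ι m R : Type*} [Fintype ι] [CommSemiring R] (c : R) (M : ι → Matrix m m R) :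
    Matrix (ι → m) (ι → m) R :=
  fun a b => c * ∏ i, M i (a i) (b i)

section smulTensor

variable {ι m R : Type*} [Fintype ι] [CommSemiring R]

lemma smulTensor_mul [DecidableEq ι] [Fintype m] (c d : R) (M M' : ι → Matrix m m R) :
    smulTensor c M * smulTensor d M' = smulTensor (c * d) (fun i => M i * M' i) := by
  ext a b
  simp only [smulTensor, Matrix.mul_apply, Fintype.prod_sum, Finset.mul_sum,
    Finset.prod_mul_distrib]
  exact Finset.sum_congr rfl fun _ _ => by ring

lemma smulTensor_smul (c : R) (s : ι → R) (M : ι → Matrix m m R) :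
    smulTensor c (fun i => s i • M i) = smulTensor (c * ∏ i, s i) M := by
  ext a b
  simp only [smulTensor, Matrix.smul_apply, smul_eq_mul, Finset.prod_mul_distrib, mul_assoc]

lemma smulTensor_one [DecidableEq m] :
    smulTensor (1 : R) (fun _ : ι => (1 : Matrix m m R)) = 1 := by
  ext a b
  simp only [smulTensor, Matrix.one_apply, one_mul, funext_iff, Fintype.prod_ite_zero,
    Finset.prod_const_one]

end smulTensor

lemma XPop_eq_smulTensor (N n : ℕ) (p : ℤ) (x z : Fin n → ℤ) :
    XPop N n p x z = smulTensor (omegaN N ^ p) (fun i => Xm ^ x i * Pm N ^ z i) := rfl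

lemma smulTensor_smul_eq_XPop (N n : ℕ) (p : ℤ) (q x z : Fin n → ℤ) :
    smulTensor (omegaN N ^ p) (fun i => omegaN N ^ q i • (Xm ^ x i * Pm N ^ z i)) =
      XPop N n (p + ∑ i, q i) x z := by
  have h : ∏ i, omegaN N ^ q i = omegaN N ^ ∑ i, q i := by
    induction (Finset.univ : Finset (Fin n)) using Finset.induction_on with
    | empty => simp
    | insert i s hi ih =>
      rw [Finset.prod_insert hi, Finset.sum_insert hi, ih, zpow_add₀ (omegaN_ne_zero N)]
  rw [smulTensor_smul, XPop_eq_smulTensor, h, zpow_add₀ (omegaN_ne_zero N)]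

lemma one_mem_XPset (N n : ℕ) :
    (1 : Matrix (Fin n → Fin 2) (Fin n → Fin 2) ℂ) ∈ XPset N n := by
  refine ⟨0, 0, 0, ?_⟩
  rw [XPop_eq_smulTensor, ← smulTensor_one]
  simp

lemma mul_mem_XPset {N n : ℕ} {A B : Matrix (Fin n → Fin 2) (Fin n → Fin 2) ℂ}
    (hA : A ∈ XPset N n) (hB : B ∈ XPset N n) : A * B ∈ XPset N n := by
  obtain ⟨p, x, z, rfl⟩ := hA
  obtain ⟨p', x', z', rfl⟩ := hB
  choose q u w h using fun i =>
    exists_mul_eq_smul_Xm_zpow_mul_Pm_zpow N (x i) (z i) (x' i) (z' i)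
  refine ⟨p + p' + ∑ i, q i, u, w, ?_⟩
  rw [← smulTensor_smul_eq_XPop, XPop_eq_smulTensor, XPop_eq_smulTensor, smulTensor_mul,
    zpow_add₀ (omegaN_ne_zero N)]
  simp only [h]

lemma exists_mem_XPset_mul_eq_one {N n : ℕ} {A : Matrix (Fin n → Fin 2) (Fin n → Fin 2) ℂ}
    (hA : A ∈ XPset N n) : ∃ B ∈ XPset N n, A * B = 1 := by
  obtain ⟨p, x, z, rfl⟩ := hA
  choose q u w h using fun i => exists_Xm_zpow_mul_Pm_zpow_mul_eq_one N (x i) (z i)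
  refine ⟨_, ⟨-p + ∑ i, q i, u, w, rfl⟩, ?_⟩
  rw [← smulTensor_smul_eq_XPop, XPop_eq_smulTensor, smulTensor_mul,
    ← zpow_add₀ (omegaN_ne_zero N), add_neg_cancel, zpow_zero, ← smulTensor_one]
  simp only [h]

/-- The XP-operators form a subgroup of the invertible 2ⁿ×2ⁿ matrices:
they contain the identity, and are closed under multiplication and inverses. -/
theorem stmt_5 (N n : ℕ) (hN : 1 ≤ N) (hn : 1 ≤ n) :
    (1 : Matrix (Fin n → Fin 2) (Fin n → Fin 2) ℂ) ∈ XPset N n ∧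
    (∀ A ∈ XPset N n, ∀ B ∈ XPset N n, A * B ∈ XPset N n) ∧
    (∀ A ∈ XPset N n, IsUnit A ∧ A⁻¹ ∈ XPset N n) := by
  refine ⟨one_mem_XPset N n, fun A hA B hB => mul_mem_XPset hA hB, fun A hA => ?_⟩
  obtain ⟨B, hB, hAB⟩ := exists_mem_XPset_mul_eq_one hA
  exact ⟨IsUnit.of_mul_eq_one B hAB, Matrix.inv_eq_right_inv hAB ▸ hB⟩
end

section
/- Two XP-operators in canonical parameter ranges are identical if and only if their components agree: for integers N ≥ 1, n ≥ 1, and parameters with 0 ≤ p, p' < 2N, x, x' ∈ {0,1}ⁿ, and 0 ≤ zᵢ, z'ᵢ < N for all i, if XP_N(p|x|z) = XP_N(p'|x'|z') as 2ⁿ × 2ⁿ matrices, then p = p', x = x', and z = z'. -/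
open Matrix Kronecker

theorem isPrimitiveRoot_omegaN {N : ℕ} (hN : 1 ≤ N) : IsPrimitiveRoot (omegaN N) (2 * N) := by
  have hN0 : (N : ℂ) ≠ 0 := Nat.cast_ne_zero.mpr (by omega)
  have h := Complex.isPrimitiveRoot_exp (2 * N) (by omega)
  convert h using 1
  unfold omegaN
  congr 1
  push_cast
  field_simp

theorem Pm_pow (N k : ℕ) : Pm N ^ k = !![1, 0; 0, omegaN N ^ (2 * k)] := by
  induction k with
  | zero => simp [Matrix.one_fin_two]
  | succ k ih => rw [pow_succ, ih, Pm, Matrix.mul_fin_two]; simp [mul_add, pow_add]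

/-- A single-qubit factor `X ^ x * P ^ z` with `x ∈ {0, 1}` has exactly one nonzero entry
in each column. -/
theorem Xm_zpow_mul_Pm_zpow_apply (N : ℕ) {x z : ℤ} (hx : 0 ≤ x ∧ x < 2) (hz : 0 ≤ z)
    (a b : Fin 2) :
    (Xm ^ x * Pm N ^ z) a b =
      if a = b + Fin.ofNat 2 x.toNat then omegaN N ^ (2 * z.toNat * b.val) else 0 := by
  lift z to ℕ using hz
  obtain rfl | rfl : x = 0 ∨ x = 1 := by omega
  all_goals
    rw [zpow_natCast, Pm_pow]
    fin_cases a <;> fin_cases b <;> simp [Xm]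

theorem XPop_apply (N n : ℕ) (p : ℤ) {x z : Fin n → ℤ} (hx : ∀ i, 0 ≤ x i ∧ x i < 2)
    (hz : ∀ i, 0 ≤ z i) (a b : Fin n → Fin 2) :
    XPop N n p x z a b = omegaN N ^ p * ∏ i, if a i = b i + Fin.ofNat 2 (x i).toNat then
      omegaN N ^ (2 * (z i).toNat * (b i).val) else 0 := by
  simp only [XPop, Xm_zpow_mul_Pm_zpow_apply N (hx _) (hz _)]

/-- XP-operators in canonical parameter ranges are uniquely determined by
their components. -/
theorem stmt_6 (N n : ℕ) (hN : 1 ≤ N) (hn : 1 ≤ n)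
    (p p' : ℤ) (x x' z z' : Fin n → ℤ)
    (hp : 0 ≤ p ∧ p < 2 * N) (hp' : 0 ≤ p' ∧ p' < 2 * N)
    (hx : ∀ i, 0 ≤ x i ∧ x i < 2) (hx' : ∀ i, 0 ≤ x' i ∧ x' i < 2)
    (hz : ∀ i, 0 ≤ z i ∧ z i < N) (hz' : ∀ i, 0 ≤ z' i ∧ z' i < N)
    (h : XPop N n p x z = XPop N n p' x' z') :
    p = p' ∧ x = x' ∧ z = z' := by
  have hω := isPrimitiveRoot_omegaN hN
  have hω0 : omegaN N ≠ 0 := hω.ne_zero (by omega)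
  have key (b : Fin n → Fin 2) :
      omegaN N ^ p * ∏ i, omegaN N ^ (2 * (z i).toNat * (b i).val) =
        omegaN N ^ p' * ∏ i, if b i + Fin.ofNat 2 (x i).toNat = b i + Fin.ofNat 2 (x' i).toNat then
          omegaN N ^ (2 * (z' i).toNat * (b i).val) else 0 := by
    have := congrFun (congrFun h fun i => b i + Fin.ofNat 2 (x i).toNat) b
    simpa only [XPop_apply N n _ hx fun i => (hz i).1, XPop_apply N n _ hx' fun i => (hz' i).1,
      if_true] using this
  have hxx : x = x' := by
    funext i
    by_contra hne
    have hbit : Fin.ofNat 2 (x i).toNat ≠ Fin.ofNat 2 (x' i).toNat := by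
      obtain h₁ | h₁ : x i = 0 ∨ x i = 1 := by have := hx i; omega
      all_goals
        obtain h₂ | h₂ : x' i = 0 ∨ x' i = 1 := by have := hx' i; omega
      all_goals simp_all
    have h0 := key 0
    refine mul_ne_zero (zpow_ne_zero p hω0) (Finset.prod_ne_zero_iff.mpr fun _ _ => pow_ne_zero _ hω0)
      (h0.trans (mul_eq_zero_of_right _ (Finset.prod_eq_zero (Finset.mem_univ i) ?_)))
    exact if_neg fun hc => hbit (add_left_cancel hc)
  subst hxx
  simp only [if_true] at key
  have hpp : p = p' := by
    have h0 := key 0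
    obtain ⟨hp0, hp1⟩ := hp
    obtain ⟨hp0', hp1'⟩ := hp'
    lift p to ℕ using hp0
    lift p' to ℕ using hp0'
    simp only [zpow_natCast, Pi.zero_apply, Fin.val_zero, mul_zero, pow_zero,
      Finset.prod_const_one, mul_one] at h0
    exact congrArg _ (hω.pow_inj (by omega) (by omega) h0)
  subst hpp
  refine ⟨rfl, rfl, funext fun j => ?_⟩
  have prod_single (w : Fin n → ℤ) :
      ∏ i, omegaN N ^ (2 * (w i).toNat * ((Pi.single j 1 : Fin n → Fin 2) i).val) =
        omegaN N ^ (2 * (w j).toNat) := by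
    rw [Finset.prod_eq_single j (fun i _ hi => by simp [hi]) (by simp)]
    simp
  have hj := mul_left_cancel₀ (zpow_ne_zero p hω0) (key (Pi.single j 1))
  rw [prod_single, prod_single] at hj
  have hzj := hz j
  have hzj' := hz' j
  have := hω.pow_inj (by omega) (by omega) hj
  omega
end
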